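/- Let (v; w₀, …, w_{n−1}) be an embedded, immersed simplicial vertex star in ℝ³ whose Gauss image has no self-intersections and whose discrete Gaussian curvature K(v) = 2π − Σᵢ ∠(wᵢ − v, wᵢ₊₁ − v) is positive. Then (a) no face Tᵢ is an inflection face, and (b) v is a convex corner: for every index i there is a sign ε ∈ {−1, 1} such that ε · ⟨wⱼ − v, mᵢ⟩ > 0 for all j ∉ {i, i+1}; that is, the star lies strictly on one side of the plane of each of its faces. (Theorem 2.8 (i), simplicial case.) -/

import Mathlib

open RealInnerProductSpace

noncomputable section

/-- Euclidean 3-space. -/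
abbrev E3 : Type := EuclideanSpace ℝ (Fin 3)

/-- The cross product on `E3`. -/
noncomputable def cross3 (a b : E3) : E3 :=
  (WithLp.equiv 2 (Fin 3 → ℝ)).symm
    ![a 1 * b 2 - a 2 * b 1, a 2 * b 0 - a 0 * b 2, a 0 * b 1 - a 1 * b 0]

/-- The face `Tᵢ = conv {v, wᵢ, wᵢ₊₁}` of a simplicial vertex star `(v; w)`;
indices are taken modulo `n`. -/
def starFace {n : ℕ} (v : E3) (w : ZMod n → E3) (i : ZMod n) : Set E3 :=
  convexHull ℝ {v, w i, w (i + 1)}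

/-- The unnormalized face normal `mᵢ = (wᵢ − v) × (wᵢ₊₁ − v)`. -/
noncomputable def starFN {n : ℕ} (v : E3) (w : ZMod n → E3) (i : ZMod n) : E3 :=
  cross3 (w i - v) (w (i + 1) - v)

/-- The unit face normal `nᵢ = mᵢ / ‖mᵢ‖`. -/
noncomputable def starUN {n : ℕ} (v : E3) (w : ZMod n → E3) (i : ZMod n) : E3 :=
  ‖starFN v w i‖⁻¹ • starFN v w i

/-- `(v; w₀, …, w_{n−1})` is an embedded, immersed simplicial vertex star:
`n ≥ 3`; consecutive edge vectors are linearly independent; distinct faces meet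
exactly in their common edge (adjacent case) or in `{v}` (non-adjacent case);
and consecutive unit normals satisfy `nᵢ₊₁ ≠ ±nᵢ`. -/
def IsStar {n : ℕ} (v : E3) (w : ZMod n → E3) : Prop :=
  3 ≤ n ∧
  (∀ i : ZMod n, LinearIndependent ℝ ![w i - v, w (i + 1) - v]) ∧
  (∀ i : ZMod n, starUN v w (i + 1) ≠ starUN v w i ∧ starUN v w (i + 1) ≠ -starUN v w i) ∧
  (∀ i j : ZMod n, i ≠ j →
    (j = i + 1 → starFace v w i ∩ starFace v w j = segment ℝ v (w j)) ∧
    (i = j + 1 → starFace v w i ∩ starFace v w j = segment ℝ v (w i)) ∧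
    (j ≠ i + 1 → i ≠ j + 1 → starFace v w i ∩ starFace v w j = {v}))

/-- The shorter great-circle arc `Arc(p, q)` joining two unit vectors `p ≠ ±q`. -/
def sArc (p q : E3) : Set E3 :=
  {x | ∃ s t : ℝ, 0 ≤ s ∧ 0 ≤ t ∧ 0 < s + t ∧ x = ‖s • p + t • q‖⁻¹ • (s • p + t • q)}

/-- The Gauss image of the vertex star (the spherical polygon with vertices `nᵢ` and
edges `Arc(nᵢ, nᵢ₊₁)`) has no self-intersections. -/
def GaussEmb {n : ℕ} (v : E3) (w : ZMod n → E3) : Prop :=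
  Function.Injective (starUN v w) ∧
  ∀ i j : ZMod n, i ≠ j →
    (j = i + 1 →
      sArc (starUN v w i) (starUN v w (i + 1)) ∩ sArc (starUN v w j) (starUN v w (j + 1)) =
        {starUN v w j}) ∧
    (i = j + 1 →
      sArc (starUN v w i) (starUN v w (i + 1)) ∩ sArc (starUN v w j) (starUN v w (j + 1)) =
        {starUN v w i}) ∧
    (j ≠ i + 1 → i ≠ j + 1 →
      sArc (starUN v w i) (starUN v w (i + 1)) ∩ sArc (starUN v w j) (starUN v w (j + 1)) = ∅)

/-- The discrete Gaussian curvature (angle defect)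
`K(v) = 2π − Σᵢ ∠(wᵢ − v, wᵢ₊₁ − v)`. -/
noncomputable def curv {n : ℕ} [NeZero n] (v : E3) (w : ZMod n → E3) : ℝ :=
  2 * Real.pi - ∑ i : ZMod n, InnerProductGeometry.angle (w i - v) (w (i + 1) - v)

/-- The face `Tᵢ` is an inflection face: its two neighboring faces lie strictly on
opposite sides of its plane. -/
def IsInflectionFace {n : ℕ} (v : E3) (w : ZMod n → E3) (i : ZMod n) : Prop :=
  ⟪w (i - 1) - v, starFN v w i⟫ * ⟪w (i + 2) - v, starFN v w i⟫ < 0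

/-- The carrier `Star = ⋃ᵢ Tᵢ` of the vertex star. -/
def starCarrier {n : ℕ} (v : E3) (w : ZMod n → E3) : Set E3 :=
  ⋃ i : ZMod n, starFace v w i


def dd (z w : ℂ) : ℝ := Complex.arg (w / z)

lemma arg_div_of_mem {z w : ℂ} (hz : z ≠ 0) (hw : w ≠ 0)
    (h1 : -Real.pi < Complex.arg w - Complex.arg z) (h2 : Complex.arg w - Complex.arg z ≤ Real.pi) :
    Complex.arg (w / z) = Complex.arg w - Complex.arg z := by
  have h := Complex.arg_div_coe_angle hw hz
  rw [← Real.Angle.coe_sub] at h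
  have h3 := congrArg Real.Angle.toReal h
  rwa [Complex.arg_coe_angle_toReal_eq_arg, (Real.Angle.toReal_coe_eq_self_iff).2 ⟨h1, h2⟩] at h3

lemma dd_half (c z w : ℂ) (hz : 0 < z.re * c.re + z.im * c.im)
    (hw : 0 < w.re * c.re + w.im * c.im) :
    dd z w = Complex.arg (w * starRingEnd ℂ c) - Complex.arg (z * starRingEnd ℂ c) := by
  have hz' : 0 < (z * starRingEnd ℂ c).re := by simpa using hz
  have hw' : 0 < (w * starRingEnd ℂ c).re := by simpa using hw
  have hz0 : z * starRingEnd ℂ c ≠ 0 := by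
    intro h; rw [h] at hz'; simp at hz'
  have hw0 : w * starRingEnd ℂ c ≠ 0 := by
    intro h; rw [h] at hw'; simp at hw'
  have hc : starRingEnd ℂ c ≠ 0 := right_ne_zero_of_mul hz0
  have a1 := abs_lt.1 (Complex.abs_arg_lt_pi_div_two_iff.2 (Or.inl hz'))
  have a2 := abs_lt.1 (Complex.abs_arg_lt_pi_div_two_iff.2 (Or.inl hw'))
  unfold dd
  rw [← mul_div_mul_right w z hc]
  apply arg_div_of_mem hz0 hw0 <;> linarith

lemma cell_zero (f0 f1 g0 g1 : ℂ) (h : Disjoint (segment ℝ f0 f1) (segment ℝ g0 g1)) :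
    dd (f0 - g0) (f1 - g0) + dd (f1 - g0) (f1 - g1) - dd (f0 - g1) (f1 - g1)
      - dd (f0 - g0) (f0 - g1) = 0 := by
  have cs : IsCompact (segment ℝ g0 g1) := by
    rw [segment_eq_image_lineMap]
    exact isCompact_Icc.image (by fun_prop)
  have cf : IsCompact (segment ℝ f0 f1) := by
    rw [segment_eq_image_lineMap]
    exact isCompact_Icc.image (by fun_prop)
  obtain ⟨φ, u, v, hu, huv, hv⟩ := geometric_hahn_banach_compact_closed
    (convex_segment g0 g1) cs (convex_segment f0 f1) cf.isClosed h.symm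
  have key : ∀ z : ℂ, φ z = z.re * φ 1 + z.im * φ Complex.I := by
    intro z
    have : z = z.re • (1:ℂ) + z.im • Complex.I := by
      simp [Complex.re_add_im]
    have e2 := congrArg φ this
    rw [map_add, map_smul, map_smul, smul_eq_mul, smul_eq_mul] at e2
    exact e2
  have k2 : ∀ f ∈ segment ℝ f0 f1, ∀ g ∈ segment ℝ g0 g1,
      0 < (f - g).re * (⟨φ 1, φ Complex.I⟩ : ℂ).re + (f - g).im * (⟨φ 1, φ Complex.I⟩ : ℂ).im := by
    intro f hf g hg
    have := hu g hg
    have := hv f hf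
    have e := key (f - g)
    rw [map_sub] at e
    simp only
    linarith
  have l0 := left_mem_segment ℝ f0 f1
  have l1 := right_mem_segment ℝ f0 f1
  have m0 := left_mem_segment ℝ g0 g1
  have m1 := right_mem_segment ℝ g0 g1
  rw [dd_half _ _ _ (k2 _ l0 _ m0) (k2 _ l1 _ m0), dd_half _ _ _ (k2 _ l1 _ m0) (k2 _ l1 _ m1),
    dd_half _ _ _ (k2 _ l0 _ m1) (k2 _ l1 _ m1), dd_half _ _ _ (k2 _ l0 _ m0) (k2 _ l0 _ m1)]
  ring

def crs (a b : ℂ) : ℝ := a.re * b.im - a.im * b.re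

lemma crs_eq (a b : ℂ) : crs a b = ‖a‖ * ‖b‖ * Real.sin (Complex.arg b - Complex.arg a) := by
  have h1 := Complex.norm_mul_cos_arg a
  have h2 := Complex.norm_mul_sin_arg a
  have h3 := Complex.norm_mul_cos_arg b
  have h4 := Complex.norm_mul_sin_arg b
  rw [Real.sin_sub]
  unfold crs
  rw [← h1, ← h2, ← h3, ← h4]
  ring

lemma corner_sep (a b : ℂ) (h : crs a b ≠ 0) : ∃ c : ℂ,
    0 < a.re * c.re + a.im * c.im ∧ 0 < (-b).re * c.re + (-b).im * c.im ∧
    0 < (a - b).re * c.re + (a-b).im * c.im := by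
  refine ⟨⟨(b.im + a.im) / crs a b, -(a.re + b.re) / crs a b⟩, ?_⟩
  have e1 : a.re * ((b.im + a.im) / crs a b) + a.im * (-(a.re + b.re) / crs a b) = 1 := by
    field_simp
    unfold crs; ring
  have e2 : b.re * ((b.im + a.im) / crs a b) + b.im * (-(a.re + b.re) / crs a b) = -1 := by
    field_simp
    unfold crs; ring
  simp only [Complex.neg_re, Complex.neg_im, Complex.sub_re, Complex.sub_im]
  refine ⟨by linarith, by linarith, by linarith⟩

lemma corner_sum (a b : ℂ) (h : crs a b ≠ 0) :
    dd a (a - b) - dd (-b) (a - b) = dd a (-b) ∧ dd (a - b) (-b) - dd (a - b) a = dd a (-b) := by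
  obtain ⟨c, h1, h2, h3⟩ := corner_sep a b h
  rw [dd_half c _ _ h1 h3, dd_half c _ _ h2 h3, dd_half c _ _ h1 h2, dd_half c _ _ h3 h2,
    dd_half c _ _ h3 h1]
  constructor <;> ring

lemma corner_val (a b : ℂ) (ha : 0 ≤ a.im) (hb : 0 ≤ b.im) :
    (0 < crs a b → dd a (-b) = Complex.arg b - Complex.arg a - Real.pi) ∧
    (crs a b < 0 → dd a (-b) = Complex.arg b - Complex.arg a + Real.pi) := by
  have pa := Complex.arg_nonneg_iff.2 ha
  have pb := Complex.arg_nonneg_iff.2 hb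
  have qa := Complex.arg_le_pi a
  have qb := Complex.arg_le_pi b
  have e := crs_eq a b
  have hpi := Real.pi_pos
  have gen : crs a b ≠ 0 → (Complex.arg (-b/a) : Real.Angle) =
      ((Complex.arg b - Complex.arg a : ℝ) : Real.Angle) + (Real.pi : Real.Angle) := by
    intro h
    have ha0 : a ≠ 0 := by rintro rfl; simp [crs] at h
    have hb0 : b ≠ 0 := by rintro rfl; simp [crs] at h
    rw [Complex.arg_div_coe_angle (neg_ne_zero.2 hb0) ha0, Complex.arg_neg_coe_angle hb0]
    rw [Real.Angle.coe_sub]; abel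
  have np : 0 ≤ ‖a‖ * ‖b‖ := by positivity
  constructor
  · intro h
    have hd : 0 < Complex.arg b - Complex.arg a := by
      by_contra hh
      have := Real.sin_nonpos_of_nonpos_of_neg_pi_le (not_lt.1 hh) (by linarith)
      nlinarith
    have hd2 : Complex.arg b - Complex.arg a ≤ Real.pi := by linarith
    have h3 := congrArg Real.Angle.toReal (gen h.ne')
    rw [← Real.Angle.sub_coe_pi_eq_add_coe_pi, ← Real.Angle.coe_sub,
      Complex.arg_coe_angle_toReal_eq_arg,
      (Real.Angle.toReal_coe_eq_self_iff).2 ⟨by linarith, by linarith⟩] at h3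
    exact h3
  · intro h
    have hd : Complex.arg b - Complex.arg a < 0 := by
      by_contra hh
      have := Real.sin_nonneg_of_nonneg_of_le_pi (not_lt.1 hh) (by linarith)
      nlinarith
    have h3 := congrArg Real.Angle.toReal (gen h.ne)
    rw [← Real.Angle.coe_add, 
      Complex.arg_coe_angle_toReal_eq_arg] at h3
    by_cases h5 : Complex.arg b - Complex.arg a + Real.pi = 0
    · have e' : Complex.arg b - Complex.arg a = -Real.pi := by linarith
      rw [e'] at e; simp at e; linarith
    rw [(Real.Angle.toReal_coe_eq_self_iff).2 ⟨by linarith, by linarith⟩] at h3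
    exact h3

lemma dd_upper (z w : ℂ) (hz : 0 ≤ z.im) (hw : 0 ≤ w.im) (h : (0:ℂ) ∉ segment ℝ z w) :
    dd z w = Complex.arg w - Complex.arg z := by
  have hz0 : z ≠ 0 := by rintro rfl; exact h (left_mem_segment ℝ _ _)
  have hw0 : w ≠ 0 := by rintro rfl; exact h (right_mem_segment ℝ _ _)
  have pa := Complex.arg_nonneg_iff.2 hz
  have pb := Complex.arg_nonneg_iff.2 hw
  have qa := Complex.arg_le_pi z
  have qb := Complex.arg_le_pi w
  apply arg_div_of_mem hz0 hw0 _ (by linarith)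
  by_contra hh
  have h1 : Complex.arg w = 0 := by linarith
  have h2 : Complex.arg z = Real.pi := by linarith
  rw [Complex.arg_eq_zero_iff] at h1
  rw [Complex.arg_eq_pi_iff] at h2
  have hwr : 0 ≤ w.re := h1.1
  apply h
  have hp : 0 < w.re - z.re := by linarith [h2.1]
  refine ⟨w.re / (w.re - z.re), -z.re / (w.re - z.re), by positivity,
    div_nonneg (by linarith) hp.le, by field_simp; ring, ?_⟩
  apply Complex.ext
  · simp only [Complex.add_re, Complex.real_smul, Complex.re_ofReal_mul, Complex.zero_re]
    field_simp; ring
  · simp only [Complex.add_im, Complex.real_smul, Complex.im_ofReal_mul, Complex.zero_im, h1.2, h2.2]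
    ring

lemma dd_neg (z w : ℂ) : dd (-z) (-w) = dd z w := by simp [dd]

lemma dd_zero_left (w : ℂ) : dd 0 w = 0 := by simp [dd]
lemma dd_zero_right (w : ℂ) : dd w 0 = 0 := by simp [dd]

lemma seg_sub (P z w : ℂ) (h : P ∉ segment ℝ z w) : (0:ℂ) ∉ segment ℝ (z - P) (w - P) := by
  rintro ⟨a, b, ha, hb, hab, e⟩
  refine h ⟨a, b, ha, hb, hab, ?_⟩
  have hab' : (a:ℂ) + b = 1 := by exact_mod_cast hab
  simp only [Complex.real_smul] at *
  linear_combination e + P * hab'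

lemma chain_start (C : ℕ → ℂ) (P : ℂ) (m : ℕ) (h0 : C 0 = P) 
    (him : ∀ s, P.im ≤ (C s).im) (hs : ∀ s, 1 ≤ s → s ≤ m → P ∉ segment ℝ (C s) (C (s+1))) :
    ∑ s ∈ Finset.range (m+1), dd (C s - P) (C (s+1) - P)
      = Complex.arg (C (m+1) - P) - Complex.arg (C 1 - P) := by
  rw [Finset.sum_range_succ', h0, sub_self, dd_zero_left, add_zero]
  rw [← Finset.sum_range_sub (fun s => Complex.arg (C (s+1) - P)) m]
  apply Finset.sum_congr rfl
  intro s h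
  rw [Finset.mem_range] at h
  exact dd_upper _ _ (by simpa using him _) (by simpa using him _)
    (seg_sub _ _ _ (hs (s+1) (by omega) (by omega)))

lemma chain_end (C : ℕ → ℂ) (P : ℂ) (m : ℕ) (h0 : C (m+1) = P) 
    (him : ∀ s, P.im ≤ (C s).im) (hs : ∀ s, s < m → P ∉ segment ℝ (C s) (C (s+1))) :
    ∑ s ∈ Finset.range (m+1), dd (C s - P) (C (s+1) - P)
      = Complex.arg (C m - P) - Complex.arg (C 0 - P) := by
  rw [Finset.sum_range_succ, h0, sub_self, dd_zero_right, add_zero]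
  rw [← Finset.sum_range_sub (fun s => Complex.arg (C (s) - P)) m]
  apply Finset.sum_congr rfl
  intro s h
  rw [Finset.mem_range] at h
  exact dd_upper _ _ (by simpa using him _) (by simpa using him _)
    (seg_sub _ _ _ (hs (s) (by omega)))

lemma grid_sum (H V : ℕ → ℕ → ℝ) (r q : ℕ) :
    ∑ s ∈ Finset.range r, ∑ t ∈ Finset.range q,
      (H s t + V (s+1) t - H s (t+1) - V s t)
    = ∑ s ∈ Finset.range r, (H s 0 - H s q) + ∑ t ∈ Finset.range q, (V r t - V 0 t) := by
  induction r with
  | zero => simp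
  | succ r ih =>
    rw [Finset.sum_range_succ, ih, Finset.sum_range_succ]
    have e1 : ∑ t ∈ Finset.range q, (H r t + V (r+1) t - H r (t+1) - V r t) =
        ∑ t ∈ Finset.range q, (V (r+1) t - V r t) - ∑ t ∈ Finset.range q, (H r (t+1) - H r t) := by
      rw [← Finset.sum_sub_distrib]
      apply Finset.sum_congr rfl
      intros; ring
    rw [e1, Finset.sum_range_sub (fun t => H r t)]
    simp only [Finset.sum_sub_distrib]
    ring

/-- Two chains from `P` to `Q` in the closed upper half plane, with `P, Q` on its boundary. -/
lemma planar (A B : ℕ → ℂ) (r q : ℕ) (hr : 1 ≤ r) (hq : 1 ≤ q) (P Q : ℂ)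
    (hA0 : A 0 = P) (hB0 : B 0 = P) (hA1 : A (r+1) = Q) (hB1 : B (q+1) = Q)
    (hP : P.im = 0) (hQ : Q.im = 0) (hA : ∀ s, 0 ≤ (A s).im) (hB : ∀ s, 0 ≤ (B s).im)
    (hd : ∀ s t, s ≤ r → t ≤ q → ¬ (s = 0 ∧ t = 0) → ¬ (s = r ∧ t = q) →
      Disjoint (segment ℝ (A s) (A (s+1))) (segment ℝ (B t) (B (t+1))))
    (h1 : crs (A 1 - P) (B 1 - P) ≠ 0) (h2 : crs (A r - Q) (B q - Q) ≠ 0) :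
    crs (A 1 - P) (B 1 - P) * crs (A r - Q) (B q - Q) < 0 := by
  have g := grid_sum (fun s t => dd (A s - B t) (A (s+1) - B t))
    (fun s t => dd (A s - B t) (A s - B (t+1))) (r+1) (q+1)
  have a1 : ∑ s ∈ Finset.range (r+1), dd (A s - B 0) (A (s+1) - B 0)
      = Complex.arg (Q - P) - Complex.arg (A 1 - P) := by
    rw [hB0, ← hA1]
    refine chain_start A P r hA0 (fun s => by rw [hP]; exact hA s) ?_
    intro s h3 h4
    have := hd s 0 h4 (by omega) (by omega) (by omega)
    rw [hB0] at this
    exact Set.disjoint_right.1 this (left_mem_segment ℝ _ _)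
  have a2 : ∑ s ∈ Finset.range (r+1), dd (A s - B (q+1)) (A (s+1) - B (q+1))
      = Complex.arg (A r - Q) - Complex.arg (P - Q) := by
    rw [hB1, ← hA0]
    refine chain_end A Q r hA1 (fun s => by rw [hQ]; exact hA s) ?_
    intro s h3
    have := hd s q h3.le (by omega) (by omega) (by omega)
    rw [hB1] at this
    exact Set.disjoint_right.1 this (right_mem_segment ℝ _ _)
  have a3 : ∑ t ∈ Finset.range (q+1), dd (A 0 - B t) (A 0 - B (t+1))
      = Complex.arg (Q - P) - Complex.arg (B 1 - P) := by
    rw [hA0, ← hB1]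
    rw [← chain_start B P q hB0 (fun s => by rw [hP]; exact hB s) ?_]
    · apply Finset.sum_congr rfl
      intro t _
      rw [← dd_neg, neg_sub, neg_sub]
    intro t h3 h4
    have := hd 0 t (by omega) h4 (by omega) (by omega)
    rw [hA0] at this
    exact Set.disjoint_left.1 this (left_mem_segment ℝ _ _)
  have a4 : ∑ t ∈ Finset.range (q+1), dd (A (r+1) - B t) (A (r+1) - B (t+1))
      = Complex.arg (B q - Q) - Complex.arg (P - Q) := by
    rw [hA1, ← hB0]
    rw [← chain_end B Q q hB1 (fun s => by rw [hQ]; exact hB s) ?_]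
    · apply Finset.sum_congr rfl
      intro t _
      rw [← dd_neg, neg_sub, neg_sub]
    intro t h3
    have := hd r t (by omega) h3.le (by omega) (by omega)
    rw [hA1] at this
    exact Set.disjoint_left.1 this (right_mem_segment ℝ _ _)
  rw [Finset.sum_sub_distrib, Finset.sum_sub_distrib, a1, a2, a3, a4] at g
  -- the sum of the cells
  set a := A 1 - P with ha
  set b := B 1 - P with hb
  set a' := A r - Q with ha'
  set b' := B q - Q with hb'
  have cells : ∀ s ∈ Finset.range (r+1), ∀ t ∈ Finset.range (q+1),
      dd (A s - B t) (A (s+1) - B t) + dd (A (s+1) - B t) (A (s+1) - B (t+1))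
        - dd (A s - B (t+1)) (A (s+1) - B (t+1)) - dd (A s - B t) (A s - B (t+1))
      = (if s = 0 then (if t = 0 then dd a (-b) else 0) else 0)
        + (if s = r then (if t = q then dd a' (-b') else 0) else 0) := by
    intro s hs t ht
    rw [Finset.mem_range] at hs ht
    by_cases c1 : s = 0 ∧ t = 0
    · obtain ⟨rfl, rfl⟩ := c1
      rw [if_pos rfl, if_pos rfl, if_neg (by omega), ← (corner_sum a b h1).1, hA0, hB0]
      have e1 : P - B 1 = -b := by rw [hb]; ring
      have e2 : A 1 - B 1 = a - b := by rw [ha, hb]; ring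
      simp only [zero_add]
      rw [sub_self, dd_zero_left, dd_zero_left, e1, e2, ← ha]
      ring
    by_cases c2 : s = r ∧ t = q
    · obtain ⟨rfl, rfl⟩ := c2
      rw [if_pos rfl, if_pos rfl, if_neg (by omega), ← (corner_sum a' b' h2).2, hA1, hB1]
      have e1 : Q - B t = -b' := by rw [hb']; ring
      have e2 : A s - B t = a' - b' := by rw [ha', hb']; ring
      rw [sub_self, dd_zero_right, dd_zero_right, e1, e2, ← ha']
      ring
    rw [cell_zero _ _ _ _ (hd s t (by omega) (by omega) c1 c2)]
    split_ifs <;> first | omega | simp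
  rw [Finset.sum_congr rfl (fun s hs => Finset.sum_congr rfl (cells s hs))] at g
  have tot : ∑ s ∈ Finset.range (r+1), ∑ t ∈ Finset.range (q+1),
      ((if s = 0 then (if t = 0 then dd a (-b) else 0) else 0)
        + (if s = r then (if t = q then dd a' (-b') else 0) else 0)) = dd a (-b) + dd a' (-b') := by
    simp only [Finset.sum_add_distrib]
    congr 1
    · rw [Finset.sum_eq_single 0 (by intro x _ hx; simp [hx]) (by simp)]
      simp
    · rw [Finset.sum_eq_single r (by intro x _ hx; simp [hx]) (by simp)]
      simp
  rw [tot] at g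
  have v1 := corner_val a b (by simp [ha, hP, hA]) (by simp [hb, hP, hB])
  have v2 := corner_val a' b' (by simp [ha', hQ, hA]) (by simp [hb', hQ, hB])
  have hpi := Real.pi_pos
  rcases lt_or_gt_of_ne h1 with k1 | k1 <;> rcases lt_or_gt_of_ne h2 with k2 | k2
  · have := v1.2 k1; have := v2.2 k2; linarith
  · exact mul_neg_of_neg_of_pos k1 k2
  · exact mul_neg_of_pos_of_neg k1 k2
  · have := v1.1 k1; have := v2.1 k2; linarith

lemma inner3 (a b : E3) : ⟪a, b⟫ = a 0 * b 0 + a 1 * b 1 + a 2 * b 2 := by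
  simp [PiLp.inner_apply, Fin.sum_univ_three]; ring

lemma cross3_0 (a b : E3) : cross3 a b 0 = a 1 * b 2 - a 2 * b 1 := by simp [cross3]
lemma cross3_1 (a b : E3) : cross3 a b 1 = a 2 * b 0 - a 0 * b 2 := by simp [cross3]
lemma cross3_2 (a b : E3) : cross3 a b 2 = a 0 * b 1 - a 1 * b 0 := by simp [cross3]

lemma ext3 {a b : E3} (h0 : a 0 = b 0) (h1 : a 1 = b 1) (h2 : a 2 = b 2) : a = b := by
  ext i; fin_cases i <;> assumption

lemma dual3 (a b c x : E3) : ⟪a, cross3 b c⟫ • x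
    = ⟪x, c⟫ • cross3 a b + ⟪x, a⟫ • cross3 b c + ⟪x, b⟫ • cross3 c a := by
  apply ext3 <;> simp only [PiLp.add_apply, PiLp.smul_apply, smul_eq_mul, inner3, cross3_0, cross3_1, cross3_2] <;> ring

lemma bac3 (u x h : E3) : cross3 u (cross3 x h) = ⟪u, h⟫ • x - ⟪u, x⟫ • h := by
  apply ext3 <;> simp only [PiLp.sub_apply, PiLp.smul_apply, smul_eq_mul, inner3, cross3_0, cross3_1, cross3_2] <;> ring

lemma cross3_zero (u : E3) : cross3 u 0 = 0 := by
  apply ext3 <;> simp [cross3_0, cross3_1, cross3_2]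

lemma det3_cyc (a b c : E3) : ⟪a, cross3 b c⟫ = ⟪c, cross3 a b⟫ := by
  simp only [inner3, cross3_0, cross3_1, cross3_2]; ring

lemma det3_left (a b : E3) : ⟪a, cross3 a b⟫ = 0 := by
  simp only [inner3, cross3_0, cross3_1, cross3_2]; ring

lemma det3_right (a b : E3) : ⟪b, cross3 a b⟫ = 0 := by
  simp only [inner3, cross3_0, cross3_1, cross3_2]; ring

def zmap (e x h u : E3) : ℂ := ⟨⟪e, u⟫ / ⟪h, u⟫, ⟪x, u⟫ / ⟪h, u⟫⟩

lemma det_mul3 (e x h a b c : E3) :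
    ⟪e, cross3 x h⟫ * ⟪a, cross3 b c⟫ =
      ⟪e, a⟫ * (⟪x, b⟫ * ⟪h, c⟫ - ⟪h, b⟫ * ⟪x, c⟫) - ⟪e, b⟫ * (⟪x, a⟫ * ⟪h, c⟫ - ⟪h, a⟫ * ⟪x, c⟫)
      + ⟪e, c⟫ * (⟪x, a⟫ * ⟪h, b⟫ - ⟪h, a⟫ * ⟪x, b⟫) := by
  simp only [inner3, cross3_0, cross3_1, cross3_2]; ring

lemma crs_zmap (e x h a b c : E3) (ha : 0 < ⟪h, a⟫) (hb : 0 < ⟪h, b⟫) (hc : 0 < ⟪h, c⟫) :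
    crs (zmap e x h c - zmap e x h b) (zmap e x h a - zmap e x h b) =
      ⟪e, cross3 x h⟫ * ⟪a, cross3 b c⟫ / (⟪h, a⟫ * ⟪h, b⟫ * ⟪h, c⟫) := by
  rw [det_mul3]
  simp only [crs, zmap, Complex.sub_re, Complex.sub_im]
  field_simp
  ring

lemma crs_swap (a b : ℂ) : crs a b = - crs b a := by unfold crs; ring

lemma eq_zero_of_orth (e x h y : E3) (h0 : ⟪e, cross3 x h⟫ ≠ 0) (h1 : ⟪e, y⟫ = 0)
    (h2 : ⟪x, y⟫ = 0) (h3 : ⟪h, y⟫ = 0) : y = 0 := by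
  have := dual3 e x h y
  rw [real_inner_comm h y, real_inner_comm e y, real_inner_comm x y, h1, h2, h3] at this
  simpa [h0] using this

lemma seg_zmap (e x h u0 u1 v0 v1 : E3) (hu0 : 0 < ⟪h, u0⟫) (hu1 : 0 < ⟪h, u1⟫)
    (hv0 : 0 < ⟪h, v0⟫) (hv1 : 0 < ⟪h, v1⟫) (h0 : ⟪e, cross3 x h⟫ ≠ 0)
    (hcone : ∀ a b c d : ℝ, 0 ≤ a → 0 ≤ b → 0 ≤ c → 0 ≤ d → 
      a • u0 + b • u1 = c • v0 + d • v1 → a • u0 + b • u1 = 0) :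
    Disjoint (segment ℝ (zmap e x h u0) (zmap e x h u1))
      (segment ℝ (zmap e x h v0) (zmap e x h v1)) := by
  rw [Set.disjoint_left]
  rintro z ⟨a, b, ha, hb, hab, rfl⟩ ⟨c, d, hc, hd, hcd, e1⟩
  have r1 := congrArg Complex.re e1
  have r2 := congrArg Complex.im e1
  simp only [zmap, Complex.add_re, Complex.add_im, Complex.smul_re, Complex.smul_im, smul_eq_mul] at r1 r2
  have hy : (a / ⟪h, u0⟫) • u0 + (b / ⟪h, u1⟫) • u1
      - ((c / ⟪h, v0⟫) • v0 + (d / ⟪h, v1⟫) • v1) = 0 := by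
    apply eq_zero_of_orth e x h _ h0
    · simp only [inner_sub_right, inner_add_right, inner_smul_right]
      linear_combination -r1
    · simp only [inner_sub_right, inner_add_right, inner_smul_right]
      linear_combination -r2
    · simp only [inner_sub_right, inner_add_right, inner_smul_right]
      field_simp
      linear_combination hab - hcd
  have := hcone _ _ _ _ (div_nonneg ha hu0.le) (div_nonneg hb hu1.le) (div_nonneg hc hv0.le)
    (div_nonneg hd hv1.le) (sub_eq_zero.1 hy)
  have t := congrArg (fun y => ⟪h, y⟫) this
  simp only [inner_add_right, inner_smul_right, inner_zero_right] at t
  field_simp at t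
  linarith

section star
variable {n : ℕ} [NeZero n]

def DD (U : ZMod n → E3) (k : ZMod n) : ℝ := ⟪U (k - 1), cross3 (U k) (U (k + 1))⟫

def ConeDisj (U : ZMod n → E3) : Prop := ∀ i j : ZMod n, i ≠ j → j ≠ i + 1 → i ≠ j + 1 →
  ∀ a b c d : ℝ, 0 ≤ a → 0 ≤ b → 0 ≤ c → 0 ≤ d →
    a • U i + b • U (i+1) = c • U j + d • U (j+1) → a • U i + b • U (i+1) = 0

lemma zmod_ne_of (n : ℕ) (m : ℕ) (h0 : 0 < m) (h1 : m < n) : ((m : ℕ) : ZMod n) ≠ 0 := by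
  intro h
  rw [ZMod.natCast_eq_zero_iff] at h
  exact absurd (Nat.le_of_dvd h0 h) (by omega)

lemma mixed (U : ZMod n → E3) (hD : ∀ k, DD U k ≠ 0) (hC : ConeDisj U)
    (h : E3) (hh : ∀ k, 0 < ⟪h, U k⟫) (x : E3) (hx : x ≠ 0) (hx0 : ∀ k, 0 ≤ ⟪x, U k⟫)
    (k k' : ZMod n) (hk : ⟪x, U k⟫ = 0) (hk' : ⟪x, U k'⟫ = 0) (n0 : k' ≠ k) (n1 : k' ≠ k + 1)
    (n2 : k ≠ k' + 1) : 0 < DD U k * DD U k' := by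
  set e := cross3 x h with he
  have he0 : e ≠ 0 := by
    intro h0
    have := bac3 (U k) x h
    rw [← he, h0, cross3_zero, real_inner_comm x (U k), hk, zero_smul, sub_zero, real_inner_comm h] at this
    rcases smul_eq_zero.1 this.symm with h3 | h3
    · exact (hh k).ne' h3
    · exact hx h3
  have hee : ⟪e, cross3 x h⟫ ≠ 0 := by rw [← he]; exact inner_self_ne_zero.2 he0
  set z : ZMod n → ℂ := fun i => zmap e x h (U i) with hz
  set ρ := (k' - k).val with hρ
  have hρn : ρ < n := ZMod.val_lt _
  have hρk : k + (ρ : ZMod n) = k' := by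
    rw [hρ, ZMod.natCast_zmod_val]; ring
  have hρ0 : ρ ≠ 0 := by
    intro h0; rw [h0] at hρk; apply n0; rw [← hρk]; simp
  have hρ1 : ρ ≠ 1 := by
    intro h0; rw [h0] at hρk; apply n1; rw [← hρk]; simp
  have hρ2 : ρ + 1 ≠ n := by
    intro h0; apply n2; rw [← hρk]
    have : ((ρ + 1 : ℕ) : ZMod n) = 0 := by rw [h0]; simp
    push_cast at this
    linear_combination -this
  obtain ⟨r, hr⟩ : ∃ r, ρ = r + 1 := ⟨ρ - 1, by omega⟩
  obtain ⟨q, hq⟩ : ∃ q, n = ρ + (q + 1) := ⟨n - ρ - 1, by omega⟩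
  have hnq : ((ρ + (q + 1) : ℕ) : ZMod n) = 0 := by rw [← hq]; simp
  have hqk : k - ((q + 1 : ℕ) : ZMod n) = k' := by
    rw [← hρk]; push_cast at hnq ⊢; linear_combination -hnq
  have him : ∀ i, 0 ≤ (z i).im := fun i => div_nonneg (hx0 i) (hh i).le
  have s1 : k + 1 - 1 = k := by ring
  have c1 : crs (z (k + 1) - z k) (z (k - 1) - z k) = ⟪e, cross3 x h⟫ * DD U k /
      (⟪h, U (k-1)⟫ * ⟪h, U k⟫ * ⟪h, U (k+1)⟫) := crs_zmap _ _ _ _ _ _ (hh _) (hh _) (hh _)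
  have c2 : crs (z (k' - 1) - z k') (z (k' + 1) - z k') = - (⟪e, cross3 x h⟫ * DD U k' /
      (⟪h, U (k'-1)⟫ * ⟪h, U k'⟫ * ⟪h, U (k'+1)⟫)) := by
    rw [crs_swap]; congr 1; exact crs_zmap _ _ _ _ _ _ (hh _) (hh _) (hh _)
  have p1 : 0 < ⟪h, U (k-1)⟫ * ⟪h, U k⟫ * ⟪h, U (k+1)⟫ := mul_pos (mul_pos (hh _) (hh _)) (hh _)
  have p2 : 0 < ⟪h, U (k'-1)⟫ * ⟪h, U k'⟫ * ⟪h, U (k'+1)⟫ := mul_pos (mul_pos (hh _) (hh _)) (hh _)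
  have key := planar (fun s => z (k + (s : ZMod n))) (fun t => z (k - (t : ZMod n))) r q
    (by omega) (by omega) (z k) (z k') (by simp) (by simp) (by rw [← hr, hρk])
    (by rw [hqk]) (by simp [hz, zmap, hk]) (by simp [hz, zmap, hk'])
    (fun s => him _) (fun s => him _) ?_ ?_ ?_
  · have er : k + (r : ZMod n) = k' - 1 := by rw [← hρk, hr]; push_cast; ring
    have eq : k - (q : ZMod n) = k' + 1 := by rw [← hqk]; push_cast; ring
    simp only [Nat.cast_one] at key
    rw [er, eq, c1, c2] at key
    have key2 : 0 < ⟪e, cross3 x h⟫ ^ 2 * (DD U k * DD U k') := by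
      rw [mul_neg, neg_lt_zero, div_mul_div_comm] at key
      have h4 := (div_pos_iff_of_pos_right (mul_pos p1 p2)).1 key
      nlinarith [h4]
    exact pos_of_mul_pos_right key2 (sq_nonneg _)
  · intro s t hs ht d1 d2
    have e1 : k + ((s + 1 : ℕ) : ZMod n) = k + s + 1 := by push_cast; ring
    have e2 : k - (t : ZMod n) = k - ((t + 1 : ℕ) : ZMod n) + 1 := by push_cast; ring
    rw [segment_symm ℝ (z (k - (t : ZMod n))), e1, e2]
    apply seg_zmap _ _ _ _ _ _ _ (hh _) (hh _) (hh _) (hh _) hee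
    apply hC
    · intro h3
      apply zmod_ne_of n (s + t + 1) (by omega) (by omega)
      push_cast at h3 ⊢; linear_combination h3
    · intro h3
      apply zmod_ne_of n (s + t + 2) (by omega) (by omega)
      push_cast at h3 ⊢; linear_combination -h3
    · intro h3
      apply zmod_ne_of n (s + t) (by omega) (by omega)
      push_cast at h3 ⊢; linear_combination h3
  · simp only [Nat.cast_one]
    rw [c1]
    exact div_ne_zero (mul_ne_zero hee (hD _)) p1.ne'
  · have er : k + (r : ZMod n) = k' - 1 := by rw [← hρk, hr]; push_cast; ring
    have eq : k - (q : ZMod n) = k' + 1 := by rw [← hqk]; push_cast; ring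
    rw [er, eq, c2]
    exact neg_ne_zero.2 (div_ne_zero (mul_ne_zero hee (hD _)) p2.ne')

def GaussDisj (U : ZMod n → E3) : Prop := ∀ i j : ZMod n, i ≠ j → j ≠ i + 1 → i ≠ j + 1 →
  ∀ a b c d : ℝ, 0 ≤ a → 0 ≤ b → 0 ≤ c → 0 ≤ d →
    a • cross3 (U i) (U (i+1)) + b • cross3 (U (i+1)) (U (i+2))
      = c • cross3 (U j) (U (j+1)) + d • cross3 (U (j+1)) (U (j+2)) →
    a • cross3 (U i) (U (i+1)) + b • cross3 (U (i+1)) (U (i+2)) = 0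

lemma contact (U : ZMod n → E3) (hD : ∀ k, DD U k ≠ 0) (hC : ConeDisj U) (hG : GaussDisj U)
    (h : E3) (hh : ∀ k, 0 < ⟪h, U k⟫) (x : E3) (hx : x ≠ 0) (hx0 : ∀ k, 0 ≤ ⟪x, U k⟫)
    (k k' : ZMod n) (hk : ⟪x, U k⟫ = 0) (hk' : ⟪x, U k'⟫ = 0) (n0 : k' ≠ k) :
    k' = k + 1 ∨ k = k' + 1 := by
  by_contra hcon
  push Not at hcon
  obtain ⟨n1, n2⟩ := hcon
  have hpos := mixed U hD hC h hh x hx hx0 k k' hk hk' n0 n1 n2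
  have e : ∀ k, ⟪x, U k⟫ = 0 → DD U k • x = ⟪x, U (k+1)⟫ • cross3 (U (k-1)) (U k)
      + ⟪x, U (k-1)⟫ • cross3 (U k) (U (k+1)) := by
    intro k hk
    have := dual3 (U (k-1)) (U k) (U (k+1)) x
    rw [hk, zero_smul, add_zero] at this
    exact this
  have e1 := e k hk
  have e2 := e k' hk'
  have habs : |DD U k'| * DD U k = |DD U k| * DD U k' := by
    rcases lt_or_gt_of_ne (hD k) with c | c
    · have : DD U k' < 0 := by by_contra hn; nlinarith
      rw [abs_of_neg c, abs_of_neg this]; ring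
    · have : 0 < DD U k' := by by_contra hn; nlinarith
      rw [abs_of_pos c, abs_of_pos this]; ring
  have g := hG (k-1) (k'-1) (fun h3 => n0 (by linear_combination -h3))
    (fun h3 => n1 (by linear_combination h3)) (fun h3 => n2 (by linear_combination h3))
    (|DD U k'| * ⟪x, U (k+1)⟫) (|DD U k'| * ⟪x, U (k-1)⟫)
    (|DD U k| * ⟪x, U (k'+1)⟫) (|DD U k| * ⟪x, U (k'-1)⟫)
    (mul_nonneg (abs_nonneg _) (hx0 _)) (mul_nonneg (abs_nonneg _) (hx0 _))
    (mul_nonneg (abs_nonneg _) (hx0 _)) (mul_nonneg (abs_nonneg _) (hx0 _))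
  have t1 : ∀ k : ZMod n, k - 1 + 1 = k := fun k => by ring
  have t2 : ∀ k : ZMod n, k - 1 + 2 = k + 1 := fun k => by ring
  rw [t1, t1, t2, t2] at g
  simp only [mul_smul] at g
  rw [← smul_add, ← smul_add, ← e1, ← e2, smul_smul, smul_smul, habs] at g
  have g2 := g rfl
  rcases smul_eq_zero.1 g2 with g3 | g3
  · rcases mul_eq_zero.1 g3 with g4 | g4
    · exact hD k (abs_eq_zero.1 g4)
    · exact hD k' g4
  · exact hx g3

lemma pivot (U : ZMod n → E3) (x f : E3) (hx0 : ∀ k, 0 ≤ ⟪x, U k⟫) (hf : ∃ k, ⟪f, U k⟫ < 0) :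
    ∃ τ : ℝ, 0 ≤ τ ∧ (∀ k, 0 ≤ ⟪x + τ • f, U k⟫) ∧ ∃ j, ⟪f, U j⟫ < 0 ∧ ⟪x + τ • f, U j⟫ = 0 := by
  classical
  obtain ⟨k0, hk0⟩ := hf
  obtain ⟨j, hj, hmin⟩ := Finset.exists_min_image (Finset.univ.filter (fun j => ⟪f, U j⟫ < 0))
    (fun j => ⟪x, U j⟫ / (-⟪f, U j⟫)) ⟨k0, by simpa using hk0⟩
  simp only [Finset.mem_filter, Finset.mem_univ, true_and] at hj hmin
  have hτ : 0 ≤ ⟪x, U j⟫ / (-⟪f, U j⟫) := div_nonneg (hx0 j) (by linarith)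
  refine ⟨⟪x, U j⟫ / (-⟪f, U j⟫), hτ, ?_, j, hj, ?_⟩
  · intro k
    rw [inner_add_left, real_inner_smul_left]
    by_cases hk : ⟪f, U k⟫ < 0
    · have := hmin k hk
      rw [le_div_iff₀ (by linarith)] at this
      linarith
    · have := mul_nonneg hτ (not_lt.1 hk)
      linarith [hx0 k]
  · rw [inner_add_left, real_inner_smul_left]
    have : ⟪f, U j⟫ ≠ 0 := hj.ne
    field_simp
    ring

lemma parallel3 {x h : E3} (hc : cross3 x h = 0) (hx : x ≠ 0) : ∃ c : ℝ, h = c • x := by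
  have := bac3 x x h
  rw [hc, cross3_zero] at this
  have hxx : ⟪x, x⟫ ≠ 0 := inner_self_ne_zero.2 hx
  refine ⟨⟪x, h⟫ / ⟪x, x⟫, ?_⟩
  rw [div_eq_inv_mul, mul_smul, sub_eq_zero.1 this.symm, smul_smul, inv_mul_cancel₀ hxx, one_smul]

/-- `ε mₖ` supports the star. -/
def Supp (U : ZMod n → E3) (k : ZMod n) : Prop :=
  ∃ ε : ℝ, (ε = -1 ∨ ε = 1) ∧ ∀ j, 0 ≤ ε * ⟪U j, cross3 (U k) (U (k+1))⟫

lemma orth3 (a b c : E3) (h : ⟪a, cross3 b c⟫ ≠ 0) (f : E3) (ha : ⟪f, a⟫ = 0) (hb : ⟪f, b⟫ = 0)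
    (hc : ⟪f, c⟫ = 0) : f = 0 := by
  have := dual3 a b c f
  rw [ha, hb, hc] at this
  simpa [h] using this

lemma supp_of_contact (U : ZMod n → E3) (hD : ∀ k, DD U k ≠ 0) (x : E3) (hx : x ≠ 0)
    (hx0 : ∀ k, 0 ≤ ⟪x, U k⟫) (k : ZMod n) (hk : ⟪x, U k⟫ = 0) (hk1 : ⟪x, U (k+1)⟫ = 0) :
    Supp U k := by
  have e := dual3 (U (k-1)) (U k) (U (k+1)) x
  rw [hk, hk1, zero_smul, zero_smul, add_zero, zero_add] at e
  have hp : 0 < ⟪x, U (k-1)⟫ := by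
    refine lt_of_le_of_ne (hx0 _) ?_
    intro h0
    exact hx (orth3 _ _ _ (hD k) x h0.symm hk hk1)
  have hj : ∀ j, DD U k * ⟪x, U j⟫ = ⟪x, U (k-1)⟫ * ⟪U j, cross3 (U k) (U (k+1))⟫ := by
    intro j
    have := congrArg (fun y => ⟪U j, y⟫) e
    simp only [real_inner_smul_right] at this
    rw [real_inner_comm x (U j)] at this
    exact this
  rcases lt_or_gt_of_ne (hD k) with c | c
  · refine ⟨-1, Or.inl rfl, fun j => ?_⟩
    have := hj j
    have h1 := hx0 j
    by_contra hn
    nlinarith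
  · refine ⟨1, Or.inr rfl, fun j => ?_⟩
    have := hj j
    have h1 := hx0 j
    by_contra hn
    nlinarith

lemma DD_succ (U : ZMod n → E3) (k : ZMod n) :
    DD U (k+1) = ⟪U k, cross3 (U (k+1)) (U (k+1+1))⟫ ∧
    DD U (k+1) = ⟪U (k+1+1), cross3 (U k) (U (k+1))⟫ := by
  have e : k + 1 - 1 = k := by ring
  constructor
  · simp [DD]
  · rw [← det3_cyc]; simp [DD]

lemma supp_succ (U : ZMod n → E3) (hD : ∀ k, DD U k ≠ 0) (hC : ConeDisj U) (hG : GaussDisj U)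
    (h : E3) (hh : ∀ k, 0 < ⟪h, U k⟫) (k : ZMod n) (hs : Supp U k) : Supp U (k+1) := by
  obtain ⟨ε, hε, hj⟩ := hs
  by_contra hcon
  have hneg : ∃ j, ⟪ε • cross3 (U (k+1)) (U (k+1+1)), U j⟫ < 0 := by
    by_contra hn
    push Not at hn
    refine hcon ⟨ε, hε, fun j => ?_⟩
    have := hn j
    rwa [real_inner_smul_left, real_inner_comm] at this
  obtain ⟨τ, hτ, hsup, j, hjn, hj0⟩ := pivot U (ε • cross3 (U k) (U (k+1)))
    (ε • cross3 (U (k+1)) (U (k+1+1)))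
    (fun j => by rw [real_inner_smul_left, real_inner_comm]; exact hj j) hneg
  set x := ε • cross3 (U k) (U (k+1)) + τ • ε • cross3 (U (k+1)) (U (k+1+1)) with hxdef
  have hε0 : ε ≠ 0 := by rcases hε with rfl | rfl <;> norm_num
  obtain ⟨d1, d2⟩ := DD_succ U k
  have i2 : ⟪x, U (k+1+1)⟫ = ε * DD U (k+1) := by
    rw [hxdef, inner_add_left, real_inner_smul_left, real_inner_smul_left, real_inner_smul_left,
      real_inner_comm, ← d2, real_inner_comm, det3_right]; ring
  have i1 : ⟪x, U (k+1)⟫ = 0 := by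
    rw [hxdef, inner_add_left, real_inner_smul_left, real_inner_smul_left, real_inner_smul_left,
      real_inner_comm, det3_right, real_inner_comm, det3_left]; ring
  have hx : x ≠ 0 := by
    intro h0
    rw [h0, inner_zero_left] at i2
    exact mul_ne_zero hε0 (hD _) i2.symm
  have hne : j ≠ k + 1 := by
    rintro rfl
    rw [real_inner_smul_left, real_inner_comm, det3_left] at hjn
    simp at hjn
  rcases contact U hD hC hG h hh x hx hsup (k+1) j i1 hj0 hne with c | c
  · subst c
    rw [real_inner_smul_left, real_inner_comm, det3_right] at hjn
    simp at hjn
  · have : j = k := by linear_combination -c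
    subst this
    rw [real_inner_smul_left, real_inner_comm, ← d1, d2] at hjn
    linarith [hj (j+1+1)]

lemma exists_neg (U : ZMod n → E3) (hD : ∀ k, DD U k ≠ 0) (f : E3) (hf : f ≠ 0) :
    (∃ k, ⟪f, U k⟫ < 0) ∨ (∃ k, ⟪-f, U k⟫ < 0) := by
  by_contra hn
  push Not at hn
  have : ∀ k, ⟪f, U k⟫ = 0 := by
    intro k
    have h1 := hn.1 k
    have h2 := hn.2 k
    rw [inner_neg_left] at h2
    linarith
  exact hf (orth3 _ _ _ (hD 0) f (this _) (this _) (this _))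

lemma exists_perp (a : E3) (ha : a ≠ 0) : ∃ f : E3, f ≠ 0 ∧ ⟪f, a⟫ = 0 := by
  by_contra hn
  push Not at hn
  have key : ∀ b : E3, cross3 a b = 0 := by
    intro b
    by_contra h0
    exact hn _ h0 (by rw [real_inner_comm, det3_left])
  have h0 := key (!₂[1,0,0])
  have h1 := key (!₂[0,1,0])
  have a1 := congrArg (fun y : E3 => y 2) h0
  have a2 := congrArg (fun y : E3 => y 1) h0
  have a3 := congrArg (fun y : E3 => y 2) h1
  simp [cross3] at a1 a2 a3
  exact ha (ext3 (by simpa using a3) (by simpa using a1) (by simpa using a2))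

lemma exists_supp (U : ZMod n → E3) (hD : ∀ k, DD U k ≠ 0) (hC : ConeDisj U) (hG : GaussDisj U)
    (h : E3) (hh : ∀ k, 0 < ⟪h, U k⟫) : ∃ k, Supp U k := by
  have hne : h ≠ 0 := by
    rintro rfl; simpa using hh 0
  obtain ⟨f, hf0, hfh, hfn⟩ : ∃ f : E3, f ≠ 0 ∧ ⟪f, h⟫ = 0 ∧ ∃ k, ⟪f, U k⟫ < 0 := by
    obtain ⟨f, hf0, hfh⟩ := exists_perp h hne
    rcases exists_neg U hD f hf0 with c | c
    · exact ⟨f, hf0, hfh, c⟩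
    · exact ⟨-f, neg_ne_zero.2 hf0, by rw [inner_neg_left, hfh, neg_zero], c⟩
  obtain ⟨τ, hτ, hsup, k, hkn, hk0⟩ := pivot U h f (fun k => (hh k).le) hfn
  set x := h + τ • f with hxdef
  have hx : x ≠ 0 := by
    intro h0
    have : ⟪x, h⟫ = ⟪h, h⟫ := by
      rw [hxdef, inner_add_left, real_inner_smul_left, hfh]; ring
    rw [h0, inner_zero_left] at this
    exact hne (inner_self_eq_zero.1 this.symm)
  have hUk : U k ≠ 0 := by
    intro h0
    have := hh k
    rw [h0, inner_zero_right] at this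
    exact lt_irrefl _ this
  obtain ⟨g, hg0, hgx, hgk, hgn⟩ : ∃ f : E3, f ≠ 0 ∧ ⟪f, x⟫ = 0 ∧ ⟪f, U k⟫ = 0 ∧
      ∃ k, ⟪f, U k⟫ < 0 := by
    have hc0 : cross3 x (U k) ≠ 0 := by
      intro h0
      obtain ⟨c, hc⟩ := parallel3 h0 hx
      rw [hc, real_inner_smul_right] at hk0
      rcases mul_eq_zero.1 hk0 with h3 | h3
      · exact hUk (by rw [hc, h3, zero_smul])
      · exact hx (inner_self_eq_zero.1 h3)
    have hcx : ⟪cross3 x (U k), x⟫ = 0 := by rw [real_inner_comm, det3_left]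
    have hck : ⟪cross3 x (U k), U k⟫ = 0 := by rw [real_inner_comm, det3_right]
    rcases exists_neg U hD _ hc0 with c | c
    · exact ⟨_, hc0, hcx, hck, c⟩
    · exact ⟨_, neg_ne_zero.2 hc0, by rw [inner_neg_left, hcx, neg_zero],
        by rw [inner_neg_left, hck, neg_zero], c⟩
  obtain ⟨σ, hσ, hsup2, j, hjn, hj0⟩ := pivot U x g hsup hgn
  set y := x + σ • g with hydef
  have hy : y ≠ 0 := by
    intro h0
    have : ⟪y, x⟫ = ⟪x, x⟫ := by
      rw [hydef, inner_add_left, real_inner_smul_left, hgx]; ring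
    rw [h0, inner_zero_left] at this
    exact hx (inner_self_eq_zero.1 this.symm)
  have hyk : ⟪y, U k⟫ = 0 := by
    rw [hydef, inner_add_left, real_inner_smul_left, hgk, hk0]; ring
  have hjk : j ≠ k := by rintro rfl; rw [hgk] at hjn; exact lt_irrefl _ hjn
  rcases contact U hD hC hG h hh y hy hsup2 k j hyk hj0 hjk with c | c
  · exact ⟨k, supp_of_contact U hD y hy hsup2 k hyk (c ▸ hj0)⟩
  · exact ⟨j, supp_of_contact U hD y hy hsup2 j hj0 (c ▸ hyk)⟩

lemma strict_all (U : ZMod n → E3) (hD : ∀ k, DD U k ≠ 0) (hC : ConeDisj U) (hG : GaussDisj U)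
    (h : E3) (hh : ∀ k, 0 < ⟪h, U k⟫) (i : ZMod n) : ∃ ε : ℝ, (ε = -1 ∨ ε = 1) ∧
      ∀ j : ZMod n, j ≠ i → j ≠ i + 1 → 0 < ε * ⟪U j, cross3 (U i) (U (i+1))⟫ := by
  obtain ⟨k, hk⟩ := exists_supp U hD hC hG h hh
  have all : ∀ m : ℕ, Supp U (k + (m : ZMod n)) := by
    intro m
    induction m with
    | zero => simpa using hk
    | succ m ih =>
      have := supp_succ U hD hC hG h hh _ ih
      rwa [Nat.cast_succ, ← add_assoc]
  have hi : Supp U i := by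
    have := all (i - k).val
    rwa [ZMod.natCast_zmod_val, add_sub_cancel] at this
  obtain ⟨ε, hε, hj⟩ := hi
  have hε0 : ε ≠ 0 := by rcases hε with rfl | rfl <;> norm_num
  refine ⟨ε, hε, fun j j0 j1 => lt_of_le_of_ne (hj j) ?_⟩
  intro h0
  set x := ε • cross3 (U i) (U (i+1)) with hxd
  have hin : ∀ j, ⟪x, U j⟫ = ε * ⟪U j, cross3 (U i) (U (i+1))⟫ := by
    intro j; rw [hxd, real_inner_smul_left, real_inner_comm]
  have hx : x ≠ 0 := by
    intro h3
    have := hin (i-1)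
    rw [h3, inner_zero_left] at this
    exact mul_ne_zero hε0 (hD i) this.symm
  have xi : ⟪x, U i⟫ = 0 := by rw [hin, det3_left, mul_zero]
  have xi1 : ⟪x, U (i+1)⟫ = 0 := by rw [hin, det3_right, mul_zero]
  have xj : ⟪x, U j⟫ = 0 := by rw [hin, ← h0]
  have hsup : ∀ j, 0 ≤ ⟪x, U j⟫ := fun j => by rw [hin]; exact hj j
  rcases contact U hD hC hG h hh x hx hsup i j xi xj j0 with c | c
  · exact j1 c
  · have : j = i - 1 := by linear_combination -c
    rw [this] at xj
    rw [hin] at xj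
    exact mul_ne_zero hε0 (hD i) xj
end star

open InnerProductGeometry in
lemma pos_of_angle (X Y Z : E3) (hX : X ≠ 0) (hY : Y ≠ 0) (hZ : Z ≠ 0)
    (h : angle X Z + angle Z Y < Real.pi) : 0 < ⟪‖X‖⁻¹ • X + ‖Y‖⁻¹ • Y, Z⟫ := by
  have h1 : Real.cos (Real.pi - angle Z Y) < Real.cos (angle X Z) := by
    apply Real.cos_lt_cos_of_nonneg_of_le_pi (angle_nonneg _ _)
    · linarith [angle_nonneg Z Y]
    · linarith
  rw [Real.cos_pi_sub, cos_angle, cos_angle] at h1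
  have nX := norm_pos_iff.2 hX
  have nY := norm_pos_iff.2 hY
  have nZ := norm_pos_iff.2 hZ
  rw [inner_add_left, real_inner_smul_left, real_inner_smul_left, real_inner_comm Z Y]
  have e : (‖X‖⁻¹ * ⟪X, Z⟫ + ‖Y‖⁻¹ * ⟪Z, Y⟫)
      = ‖Z‖ * (⟪X, Z⟫ / (‖X‖ * ‖Z‖) + ⟪Z, Y⟫ / (‖Z‖ * ‖Y‖)) := by
    field_simp
  rw [e]
  apply mul_pos nZ
  linarith

open InnerProductGeometry in
lemma chain_angle (u : ℕ → E3) (hu : ∀ i, u i ≠ 0) (a b : ℕ) (hab : a ≤ b) :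
    angle (u a) (u b) ≤ ∑ i ∈ Finset.range b, angle (u i) (u (i+1))
      - ∑ i ∈ Finset.range a, angle (u i) (u (i+1)) := by
  induction b, hab using Nat.le_induction with
  | base => rw [angle_self (hu a)]; simp
  | succ b hb ih =>
    rw [Finset.sum_range_succ]
    have := angle_le_angle_add_angle (u a) (u b) (u (b+1))
    linarith

open InnerProductGeometry in
lemma split_arc (a b : E3) (hab : LinearIndependent ℝ ![a, b]) (c : ℝ) (h0 : 0 ≤ c)
    (h1 : c ≤ angle a b) : ∃ Y : E3, Y ≠ 0 ∧ angle a Y = c ∧ angle Y b = angle a b - c := by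
  have hp := LinearIndependent.pair_iff.1 hab
  have ha : a ≠ 0 := hab.ne_zero 0
  have hne : ∀ t : ℝ, (1 - t) • a + t • b ≠ 0 := by
    intro t h
    obtain ⟨h2, h3⟩ := hp _ _ h
    linarith
  have hcont : Continuous (fun t : ℝ => angle a ((1 - t) • a + t • b)) := by
    rw [continuous_iff_continuousAt]
    intro t
    have := continuousAt_angle (x := (a, (1 - t) • a + t • b)) ha (hne t)
    exact ContinuousAt.comp (f := fun t : ℝ => (a, (1 - t) • a + t • b)) this (by fun_prop)
  obtain ⟨t, ht, e⟩ := intermediate_value_Icc (zero_le_one' ℝ) hcont.continuousOn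
    (show c ∈ Set.Icc _ _ by simpa [ha] using ⟨h0, h1⟩)
  simp only at e
  refine ⟨_, hne t, e, ?_⟩
  have := (angle_eq_angle_add_angle_iff (x := a) (z := b) (hne t)).2 (Or.inr ?_)
  · linarith
  · rw [Submodule.mem_span_pair]
    exact ⟨⟨1 - t, by linarith [ht.2]⟩, ⟨t, ht.1⟩, rfl⟩

open InnerProductGeometry in
lemma hemisphere (u : ℕ → E3) (n : ℕ) (hn : 0 < n) (hper : u n = u 0)
    (hli : ∀ i, LinearIndependent ℝ ![u i, u (i+1)])
    (hL : ∑ i ∈ Finset.range n, angle (u i) (u (i+1)) < 2 * Real.pi) :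
    ∃ h : E3, ∀ j, j ≤ n → 0 < ⟪h, u j⟫ := by
  have hu : ∀ i, u i ≠ 0 := fun i => (hli i).ne_zero 0
  set S : ℕ → ℝ := fun k => ∑ i ∈ Finset.range k, angle (u i) (u (i+1)) with hS
  have hSs : ∀ k, S (k+1) = S k + angle (u k) (u (k+1)) := fun k => Finset.sum_range_succ _ _
  have hS0 : S 0 = 0 := by simp [hS]
  have hSn : 0 ≤ S n := Finset.sum_nonneg (fun i _ => angle_nonneg _ _)
  obtain ⟨i, hi, hi1, hi2⟩ : ∃ i, i < n ∧ S i ≤ S n / 2 ∧ S n / 2 ≤ S (i+1) := by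
    by_contra hcon
    push Not at hcon
    have : ∀ k, k ≤ n → S k ≤ S n / 2 := by
      intro k
      induction k with
      | zero => intro _; rw [hS0]; linarith
      | succ k ih => intro hk; exact (hcon k (by omega) (ih (by omega))).le
    have h1 := hcon (n-1) (by omega) (this _ (by omega))
    rw [Nat.sub_add_cancel hn] at h1
    linarith
  obtain ⟨Y, hY, e1, e2⟩ := split_arc (u i) (u (i+1)) (hli i) (S n / 2 - S i) (by linarith)
    (by linarith [hSs i])
  refine ⟨‖u 0‖⁻¹ • u 0 + ‖Y‖⁻¹ • Y, fun j hj => pos_of_angle _ _ _ (hu 0) hY (hu j) ?_⟩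
  have hL' : S n < 2 * Real.pi := hL
  by_cases hji : j ≤ i
  · have c1 : angle (u 0) (u j) ≤ S j - S 0 := chain_angle u hu 0 j (by omega)
    have c2 : angle (u j) (u i) ≤ S i - S j := chain_angle u hu j i hji
    have c3 := angle_le_angle_add_angle (u j) (u i) Y
    linarith
  · have c1 : angle (u (i+1)) (u j) ≤ S j - S (i+1) := chain_angle u hu (i+1) j (by omega)
    have c2 : angle (u j) (u n) ≤ S n - S j := chain_angle u hu j n hj
    have c3 := angle_le_angle_add_angle Y (u (i+1)) (u j)
    rw [hper, angle_comm] at c2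
    rw [angle_comm (u j) Y]
    have := hSs i
    linarith

lemma sum_zmod (n : ℕ) [NeZero n] (f : ZMod n → ℝ) :
    ∑ i : ZMod n, f i = ∑ i ∈ Finset.range n, f (i : ZMod n) := by
  symm
  apply Finset.sum_bij (fun (i : ℕ) _ => (i : ZMod n))
  · intros; simp
  · intro a ha b hb h
    rw [Finset.mem_range] at ha hb
    have := congrArg ZMod.val h
    rwa [ZMod.val_cast_of_lt ha, ZMod.val_cast_of_lt hb] at this
  · intro b _
    exact ⟨b.val, Finset.mem_range.2 (ZMod.val_lt b), ZMod.natCast_zmod_val b⟩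
  · intros; rfl

lemma cross_ne_zero {a b : E3} (hab : LinearIndependent ℝ ![a, b]) : cross3 a b ≠ 0 := by
  intro h
  have ha : a ≠ 0 := hab.ne_zero 0
  obtain ⟨c, hc⟩ := parallel3 h ha
  have := (LinearIndependent.pair_iff.1 hab c (-1) (by rw [hc]; simp)).2
  norm_num at this

lemma crossThree_cross (a b c : E3) : cross3 (cross3 a b) (cross3 b c) = ⟪a, cross3 b c⟫ • b := by
  apply ext3 <;> simp only [PiLp.smul_apply, smul_eq_mul, inner3, cross3_0, cross3_1, cross3_2] <;> ring

lemma unit_parallel {x y : E3} (hx : x ≠ 0) (hy : y ≠ 0) (h : cross3 x y = 0) :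
    ‖y‖⁻¹ • y = ‖x‖⁻¹ • x ∨ ‖y‖⁻¹ • y = -(‖x‖⁻¹ • x) := by
  obtain ⟨c, rfl⟩ := parallel3 h hx
  have nx := norm_pos_iff.2 hx
  have hc : c ≠ 0 := by rintro rfl; simp at hy
  rw [norm_smul, smul_smul, ← neg_smul]
  rcases lt_or_gt_of_ne hc with k | k
  · right; congr 1; rw [Real.norm_eq_abs, abs_of_neg k]; field_simp
  · left; congr 1; rw [Real.norm_eq_abs, abs_of_pos k]; field_simp

lemma hull_mem (v p q : E3) (a b : ℝ) (ha : 0 ≤ a) (hb : 0 ≤ b) (hab : a + b ≤ 1) :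
    v + (a • (p - v) + b • (q - v)) ∈ convexHull ℝ {v, p, q} := by
  have hc := convex_convexHull ℝ ({v, p, q} : Set E3)
  have := hc.sum_mem (t := Finset.univ) (w := ![1 - a - b, a, b]) (z := ![v, p, q])
    (by intro i _; fin_cases i <;> simp <;> linarith) (by simp [Fin.sum_univ_three]; ring)
    (by intro i _; apply subset_convexHull; fin_cases i <;> simp)
  rw [Fin.sum_univ_three] at this
  convert this using 1
  simp
  module

lemma arc_mem (x y : E3) (hx : x ≠ 0) (hy : y ≠ 0) (a b : ℝ) (ha : 0 ≤ a) (hb : 0 ≤ b)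
    (h : a • x + b • y ≠ 0) :
    ‖a • x + b • y‖⁻¹ • (a • x + b • y) ∈ sArc (‖x‖⁻¹ • x) (‖y‖⁻¹ • y) := by
  have nx := norm_pos_iff.2 hx
  have ny := norm_pos_iff.2 hy
  have e : (a * ‖x‖) • ‖x‖⁻¹ • x + (b * ‖y‖) • ‖y‖⁻¹ • y = a • x + b • y := by
    rw [smul_smul, smul_smul, mul_assoc, mul_assoc, mul_inv_cancel₀ nx.ne', mul_inv_cancel₀ ny.ne',
      mul_one, mul_one]
  refine ⟨a * ‖x‖, b * ‖y‖, by positivity, by positivity, ?_, by rw [e]⟩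
  by_contra hn
  have h1 : 0 ≤ a * ‖x‖ := by positivity
  have h2 : 0 ≤ b * ‖y‖ := by positivity
  have h3 : a * ‖x‖ = 0 := by linarith
  have h4 : b * ‖y‖ = 0 := by linarith
  rw [h3, h4] at e
  apply h
  rw [← e]; simp

/-- Theorem 2.8 (i), simplicial case: for an embedded, immersed simplicial vertex star
whose Gauss image has no self-intersections and whose discrete Gaussian curvature is
positive, (a) no face is an inflection face, and (b) the vertex is a convex corner:
the star lies strictly on one side of the plane of each of its faces. -/
theorem stmt2 {n : ℕ} [NeZero n] (v : E3) (w : ZMod n → E3)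
    (hstar : IsStar v w) (hG : GaussEmb v w) (hK : 0 < curv v w) :
    (∀ i : ZMod n, ¬ IsInflectionFace v w i) ∧
    (∀ i : ZMod n, ∃ ε : ℝ, (ε = -1 ∨ ε = 1) ∧
      ∀ j : ZMod n, j ≠ i → j ≠ i + 1 → 0 < ε * ⟪w j - v, starFN v w i⟫) := by
  obtain ⟨hn, hli, hun, hface⟩ := hstar
  obtain ⟨-, harc⟩ := hG
  set U : ZMod n → E3 := fun i => w i - v with hU
  have hliU : ∀ i, LinearIndependent ℝ ![U i, U (i+1)] := hli
  have hFN : ∀ i, starFN v w i = cross3 (U i) (U (i+1)) := fun i => rfl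
  have hN0 : ∀ i, cross3 (U i) (U (i+1)) ≠ 0 := fun i => cross_ne_zero (hliU i)
  have hD : ∀ k, DD U k ≠ 0 := by
    intro k h0
    have e1 : k - 1 + 1 = k := by ring
    have hc := crossThree_cross (U (k-1)) (U k) (U (k+1))
    have h0' : ⟪U (k - 1), cross3 (U k) (U (k + 1))⟫ = 0 := h0
    rw [h0', zero_smul] at hc
    have n1 := hN0 (k-1)
    rw [e1] at n1
    have hh := hun (k-1)
    unfold starUN at hh
    rw [hFN, hFN, e1] at hh
    rcases unit_parallel n1 (hN0 k) hc with h | h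
    · exact hh.1 h
    · exact hh.2 h
  have hC : ConeDisj U := by
    intro i j hij h1 h2 a b c d ha hb hc hd e
    have hf := (hface i j hij).2.2 h1 h2
    set ε := (1 + a + b + c + d)⁻¹ with hε
    have hpos : 0 < 1 + a + b + c + d := by linarith
    have hε0 : 0 < ε := inv_pos.2 hpos
    have hεm : ε * (1 + a + b + c + d) = 1 := inv_mul_cancel₀ hpos.ne'
    have qa := mul_nonneg hε0.le ha
    have qb := mul_nonneg hε0.le hb
    have qc := mul_nonneg hε0.le hc
    have qd := mul_nonneg hε0.le hd
    have m1 := hull_mem v (w i) (w (i+1)) (ε * a) (ε * b) qa qb (by linarith)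
    have m2 := hull_mem v (w j) (w (j+1)) (ε * c) (ε * d) qc qd (by linarith)
    have e1 : (ε * a) • (w i - v) + (ε * b) • (w (i+1) - v) = ε • (a • U i + b • U (i+1)) := by
      rw [smul_add, smul_smul, smul_smul]
    have e2 : (ε * c) • (w j - v) + (ε * d) • (w (j+1) - v) = ε • (a • U i + b • U (i+1)) := by
      rw [e, smul_add, smul_smul, smul_smul]
    rw [e1] at m1
    rw [e2] at m2
    have m3 : v + ε • (a • U i + b • U (i+1)) ∈ starFace v w i ∩ starFace v w j := ⟨m1, m2⟩
    rw [hf, Set.mem_singleton_iff, add_eq_left] at m3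
    exact (smul_eq_zero.1 m3).resolve_left hε0.ne'
  have hGd : GaussDisj U := by
    intro i j hij h1 h2 a b c d ha hb hc hd e
    have e12 : ∀ i : ZMod n, i + 2 = i + 1 + 1 := fun i => by ring
    rw [e12, e12] at e
    rw [e12]
    by_contra hne
    have m1 := arc_mem _ _ (hN0 i) (hN0 (i+1)) a b ha hb hne
    have m2 := arc_mem _ _ (hN0 j) (hN0 (j+1)) c d hc hd (e ▸ hne)
    rw [← e] at m2
    have hf := (harc i j hij).2.2 h1 h2
    exact (Set.eq_empty_iff_forall_notMem.1 hf _) ⟨m1, m2⟩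
  obtain ⟨h, hh⟩ : ∃ h : E3, ∀ k, 0 < ⟪h, U k⟫ := by
    unfold curv at hK
    rw [sum_zmod] at hK
    obtain ⟨h, hh⟩ := hemisphere (fun j : ℕ => U (j : ZMod n)) n (by omega) (by simp)
      (fun i => by simpa using hliU (i : ZMod n)) (by
        simp only [Nat.cast_add, Nat.cast_one]
        linarith)
    refine ⟨h, fun k => ?_⟩
    have := hh k.val (ZMod.val_lt k).le
    simpa using this
  have main := strict_all U hD hC hGd h hh
  refine ⟨fun i hinf => ?_, main⟩
  obtain ⟨ε, hε, hj⟩ := main i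
  have hinf' : ⟪U (i-1), cross3 (U i) (U (i+1))⟫ * ⟪U (i+2), cross3 (U i) (U (i+1))⟫ < 0 := hinf
  have k1 : ((1 : ℕ) : ZMod n) ≠ 0 := zmod_ne_of n 1 (by omega) (by omega)
  have k2 : ((2 : ℕ) : ZMod n) ≠ 0 := zmod_ne_of n 2 (by omega) (by omega)
  push_cast at k1 k2
  have p1 := hj (i-1) (fun h3 => k1 (by linear_combination -h3))
    (fun h3 => k2 (by linear_combination -h3))
  have p2 := hj (i+2) (fun h3 => k2 (by linear_combination h3))
    (fun h3 => k1 (by linear_combination h3))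
  have p3 := mul_pos p1 p2
  have hε2 : ε * ε = 1 := by rcases hε with rfl | rfl <;> norm_num
  nlinarith
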